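/- Characterization of low functions: A partial function F :⊆ ℕ^ℕ → ℕ^ℕ is low if and only if G ∘ F is limit computable for every limit computable G :⊆ ℕ^ℕ → ℕ^ℕ. -/

import Mathlib

open scoped Classical

namespace LimitComp

/-- Baire space `ℕ^ℕ`. -/
abbrev Baire : Type := ℕ → ℕ

/-- The finite prefix of length `k` of a point of Baire space. -/
def pre (p : Baire) (k : ℕ) : List ℕ := List.ofFn fun i : Fin k => p i

/-- Interleaving pairing `⟨q,p⟩(2n) = q(n)`, `⟨q,p⟩(2n+1) = p(n)`. -/
def pairB (q p : Baire) : Baire := fun n => if n % 2 = 0 then q (n / 2) else p (n / 2)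

/-- The `i`-th component of a tupling `⟨p₀,p₁,p₂,...⟩`. -/
def seqOf (p : Baire) (i : ℕ) : Baire := fun n => p (Nat.pair i n)

/-- Tupling `⟨p₀,p₁,p₂,...⟩` of a sequence of points of Baire space. -/
def tup (ps : ℕ → Baire) : Baire := fun m => ps m.unpair.1 m.unpair.2

/-- The limit map `lim :⊆ ℕ^ℕ → ℕ^ℕ`; it maps `⟨p₀,p₁,p₂,...⟩` to its pointwise
limit, which is defined whenever every coordinate is eventually constant. -/
noncomputable def limB : Baire →. Baire := fun p =>
  ⟨∀ n, ∃ i₀, ∀ i, i₀ ≤ i → seqOf p i n = seqOf p i₀ n,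
   fun h n => seqOf p (Classical.choose (h n)) n⟩

/-- Monotonicity of a finite approximation function under prefix extension
(this corresponds to a one-way output tape). -/
def PrefixMono (η : List ℕ → ℕ → Option ℕ) : Prop :=
  ∀ u v n y, u <+: v → η u n = some y → η v n = some y

/-- `η` approximates the partial function `F`: for every input in the domain of `F`
every output position is eventually filled with the correct output value. -/
def OneWayApprox (η : List ℕ → ℕ → Option ℕ) (F : Baire →. Baire) : Prop :=
  ∀ p q, q ∈ F p → ∀ n, ∃ k, η (pre p k) n = some (q n)

/-- Computability for partial functions on Baire space: `F` is computed by a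
Turing machine with one-way output tape, formalized via a computable monotone
finite approximation function. -/
def ComputableFn (F : Baire →. Baire) : Prop :=
  ∃ η : List ℕ → ℕ → Option ℕ, Computable₂ η ∧ PrefixMono η ∧ OneWayApprox η F

/-- `η` is a limit approximation of `F`: on every input in the domain of `F`,
every output cell eventually stabilizes to the correct output value. -/
def LimitApprox (η : List ℕ → ℕ → ℕ) (F : Baire →. Baire) : Prop :=
  ∀ p q, q ∈ F p → ∀ n, ∃ k₀, ∀ k, k₀ ≤ k → η (pre p k) n = q n

/-- Limit computability for partial functions on Baire space: `F` is computed by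
a Turing machine with a two-way output tape such that on inputs in the domain
every output cell eventually stabilizes. -/
def LimitComputableFn (F : Baire →. Baire) : Prop :=
  ∃ η : List ℕ → ℕ → ℕ, Computable₂ η ∧ LimitApprox η F

/-- The `i`-th Turing machine halts on input `p ∈ ℕ^ℕ` (i.e. it halts after
having read some finite prefix of `p`). -/
def haltsOn (i : ℕ) (p : Baire) : Prop :=
  ∃ k, ((Denumerable.ofNat Nat.Partrec.Code i).eval (Encodable.encode (pre p k))).Dom

/-- The Turing jump operator `J : ℕ^ℕ → ℕ^ℕ`. -/
noncomputable def jump (p : Baire) : Baire := fun i => if haltsOn i p then 1 else 0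

/-- The halting problem `0'`. -/
noncomputable def zero' : Baire := jump fun _ => 0

/-- `F` is computable relative to the oracle `q`. -/
def ComputableRel (q : Baire) (F : Baire →. Baire) : Prop :=
  ∃ G : Baire →. Baire, ComputableFn G ∧ ∀ p r, r ∈ F p → r ∈ G (pairB q p)

/-- `F` is limit computable relative to the oracle `q`. -/
def LimitComputableRel (q : Baire) (F : Baire →. Baire) : Prop :=
  ∃ G : Baire →. Baire, LimitComputableFn G ∧ ∀ p r, r ∈ F p → r ∈ G (pairB q p)

/-- Turing reducibility for points of Baire space. -/
def TuringLe (p q : Baire) : Prop :=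
  ∃ F : Baire →. Baire, ComputableFn F ∧ p ∈ F q

end LimitComp

namespace LimitComp

/-- The partial inverse `J⁻¹ :⊆ ℕ^ℕ → ℕ^ℕ` of the Turing jump, with domain the
range of `J`. -/
noncomputable def jumpInv : Baire →. Baire := fun s =>
  ⟨∃ q : Baire, jump q = s, fun h => Classical.choose h⟩

/-- The low map `L := J⁻¹ ∘ lim`. -/
noncomputable def lowMap : Baire →. Baire := jumpInv.comp limB

/-- A partial function `F :⊆ ℕ^ℕ → ℕ^ℕ` is low if `F = L ∘ G` for some
computable `G`. -/
def LowFn (F : Baire →. Baire) : Prop :=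
  ∃ G : Baire →. Baire, ComputableFn G ∧ F = lowMap.comp G

/-- The least `t < K` with `P t = true`, if there is one. -/
def boundedFind (P : ℕ → Bool) (K : ℕ) : Option ℕ :=
  Nat.rec none (fun t o => Option.casesOn o (bif P t then some t else none) some) K

theorem boundedFind_succ (P : ℕ → Bool) (K : ℕ) :
    boundedFind P (K + 1) =
      Option.casesOn (boundedFind P K) (bif P K then some K else none) some :=
  rfl

theorem boundedFind_eq_none {P : ℕ → Bool} {K : ℕ} (h : ∀ t < K, P t = false) :
    boundedFind P K = none := by
  induction K with
  | zero => rfl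
  | succ K ih =>
    rw [boundedFind_succ, ih fun t ht => h t (by omega), h K (by omega)]
    rfl

theorem boundedFind_eq_some {P : ℕ → Bool} {K t : ℕ} (htK : t < K) (ht : P t = true)
    (h : ∀ s < t, P s = false) : boundedFind P K = some t := by
  induction K with
  | zero => omega
  | succ K ih =>
    rw [boundedFind_succ]
    rcases Nat.lt_succ_iff_lt_or_eq.1 htK with hlt | rfl
    · rw [ih hlt]
    · rw [boundedFind_eq_none h, ht]
      rfl

theorem isSome_boundedFind_iff {P : ℕ → Bool} {K : ℕ} :
    (boundedFind P K).isSome = true ↔ ∃ t < K, P t = true := by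
  constructor
  · intro h
    by_contra! hn
    rw [boundedFind_eq_none fun t ht => by simpa using hn t ht] at h
    simp at h
  · rintro ⟨t, htK, ht⟩
    have hex : ∃ t, P t = true := ⟨t, ht⟩
    rw [boundedFind_eq_some (lt_of_le_of_lt (Nat.find_min' hex ht) htK) (Nat.find_spec hex)
      fun s hs => by simpa using Nat.find_min hex hs]
    rfl

theorem computable_boundedFind {α : Type*} [Primcodable α] {P : α → ℕ → Bool} {K : α → ℕ}
    (hP : Computable₂ P) (hK : Computable K) :
    Computable fun a => boundedFind (P a) (K a) := by
  have ht : Computable fun x : α × ℕ × Option ℕ => x.2.1 :=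
    Computable.fst.comp Computable.snd
  refine Computable.nat_rec (h := fun a (x : ℕ × Option ℕ) =>
    Option.casesOn x.2 (bif P a x.1 then some x.1 else none) some) hK (Computable.const none) ?_
  refine Computable.option_casesOn (Computable.snd.comp Computable.snd) ?_
    (Computable.option_some.comp Computable.snd).to₂
  exact Computable.cond (hP.comp Computable.fst ht) (Computable.option_some.comp ht)
    (Computable.const none)

@[simp]
theorem length_pre (p : Baire) (k : ℕ) : (pre p k).length = k := by
  simp [pre]

theorem take_pre (p : Baire) {j k : ℕ} (h : j ≤ k) : (pre p k).take j = pre p j := by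
  apply List.ext_getElem
  · simp [h]
  · intro i h₁ h₂
    simp [pre]

theorem pre_prefix (p : Baire) {j k : ℕ} (h : j ≤ k) : pre p j <+: pre p k :=
  take_pre p h ▸ List.take_prefix _ _

theorem eq_of_pre_eq {p q : Baire} {n k : ℕ} (h : pre p k = pre q (n + 1)) : p n = q n := by
  obtain rfl : k = n + 1 := by simpa using congrArg List.length h
  have := congrFun (List.ofFn_injective h) ⟨n, n.lt_succ_self⟩
  exact this

/-- A computable family of computable sets of prefixes has a computable family of indices. -/
theorem exists_computable_haltsOn {P : ℕ → List ℕ → Bool} (hP : Computable₂ P) :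
    ∃ e : ℕ → ℕ, Computable e ∧ ∀ a q, haltsOn (e a) q ↔ ∃ k, P a (pre q k) = true := by
  let Q : ℕ → Bool := fun x => P x.unpair.1 (Denumerable.ofNat (List ℕ) x.unpair.2)
  have hQ : Computable Q := hP.comp (Computable.fst.comp Computable.unpair)
    ((Computable.ofNat (List ℕ)).comp (Computable.snd.comp Computable.unpair))
  have hf : Partrec fun x => bif Q x then Part.some 0 else (Part.none : Part ℕ) :=
    Partrec.cond hQ (Computable.const 0).partrec Partrec.none
  obtain ⟨c, hc⟩ := Nat.Partrec.Code.exists_code.1 (Partrec.nat_iff.1 hf)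
  refine ⟨fun a => Encodable.encode (c.curry a), Computable.encode.comp
    (Nat.Partrec.Code.primrec₂_curry.to_comp.comp (Computable.const c) Computable.id), ?_⟩
  intro a q
  refine exists_congr fun k => ?_
  rw [Denumerable.ofNat_encode, Nat.Partrec.Code.eval_curry, hc]
  have hQP : Q (Nat.pair a (Encodable.encode (pre q k))) = P a (pre q k) := by
    simp [Q]
  simp only [hQP]
  cases P a (pre q k) <;> simp

theorem jump_injective : Function.Injective jump := by
  intro p q h
  funext n
  have hP : Computable₂ fun (_ : ℕ) (v : List ℕ) => decide (v = pre q (n + 1)) :=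
    (Primrec.eq.comp Primrec.snd (Primrec.const _)).decide.to_comp.to₂
  obtain ⟨e, -, he⟩ := exists_computable_haltsOn hP
  have hq : haltsOn (e 0) q := (he 0 q).2 ⟨n + 1, by simp⟩
  have hp : haltsOn (e 0) p := by
    by_contra hp
    have := congrFun h (e 0)
    simp [jump, hp, hq] at this
  obtain ⟨k, hk⟩ := (he 0 p).1 hp
  exact eq_of_pre_eq (by simpa using hk)

theorem mem_jumpInv_iff {s q : Baire} : q ∈ jumpInv s ↔ jump q = s := by
  constructor
  · rintro ⟨h, rfl⟩
    exact Classical.choose_spec h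
  · intro h
    have hex : ∃ q, jump q = s := ⟨q, h⟩
    exact ⟨hex, jump_injective ((Classical.choose_spec hex).trans h.symm)⟩

theorem mem_limB_iff {r s : Baire} :
    s ∈ limB r ↔ ∀ n, ∃ i₀, ∀ i, i₀ ≤ i → r (Nat.pair i n) = s n := by
  constructor
  · rintro ⟨h, rfl⟩ n
    exact ⟨Classical.choose (h n), Classical.choose_spec (h n)⟩
  · intro h
    have hd : ∀ n, ∃ i₀, ∀ i, i₀ ≤ i → seqOf r i n = seqOf r i₀ n := fun n => by
      obtain ⟨i₀, hi₀⟩ := h n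
      exact ⟨i₀, fun i hi => (hi₀ i hi).trans (hi₀ i₀ le_rfl).symm⟩
    refine ⟨hd, funext fun n => ?_⟩
    obtain ⟨i₀, hi₀⟩ := h n
    have hc := Classical.choose_spec (hd n) (max i₀ (Classical.choose (hd n))) (le_max_right _ _)
    exact hc.symm.trans (hi₀ _ (le_max_left _ _))

theorem mem_comp_iff {G F : Baire →. Baire} {p r : Baire} :
    r ∈ G.comp F p ↔ ∃ q ∈ F p, r ∈ G q := by
  exact Part.mem_bind_iff

theorem LimitComputableFn.mono {F G : Baire →. Baire} (hG : LimitComputableFn G)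
    (h : ∀ p q, q ∈ F p → q ∈ G p) : LimitComputableFn F := by
  obtain ⟨η, hη, hG⟩ := hG
  exact ⟨η, hη, fun p q hq => hG p q (h p q hq)⟩

theorem limitComputableFn_jump : LimitComputableFn (jump : Baire →. Baire) := by
  let P : List ℕ × ℕ → ℕ → Bool := fun x k =>
    (Nat.Partrec.Code.evaln x.1.length (Denumerable.ofNat Nat.Partrec.Code x.2)
      (Encodable.encode (x.1.take k))).isSome
  have hP : Computable₂ P := by
    have hlen : Primrec fun x : (List ℕ × ℕ) × ℕ => x.1.1.length :=
      Primrec.list_length.comp (Primrec.fst.comp Primrec.fst)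
    have hcode : Primrec fun x : (List ℕ × ℕ) × ℕ =>
        Denumerable.ofNat Nat.Partrec.Code x.1.2 :=
      (Primrec.ofNat _).comp (Primrec.snd.comp Primrec.fst)
    have htake : Primrec fun x : (List ℕ × ℕ) × ℕ => Encodable.encode (x.1.1.take x.2) :=
      Primrec.encode.comp (Primrec.list_take.comp Primrec.snd (Primrec.fst.comp Primrec.fst))
    exact (Primrec.option_isSome.comp
      (Nat.Partrec.Code.primrec_evaln.comp ((hlen.pair hcode).pair htake))).to_comp
  refine ⟨fun u i => bif (boundedFind (P (u, i)) (u.length + 1)).isSome then 1 else 0, ?_, ?_⟩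
  · refine Computable.cond (Primrec.option_isSome.to_comp.comp (computable_boundedFind hP ?_))
      (Computable.const 1) (Computable.const 0)
    exact Computable.succ.comp (Computable.list_length.comp Computable.fst)
  · intro p q hq i
    obtain rfl : jump p = q := by simpa [eq_comm] using hq
    by_cases hi : haltsOn i p
    · obtain ⟨j, hj⟩ := hi
      obtain ⟨y, hy⟩ := Part.dom_iff_mem.1 hj
      obtain ⟨s, hs⟩ := Nat.Partrec.Code.evaln_complete.1 hy
      refine ⟨max j s, fun k hk => ?_⟩
      have hfind : (boundedFind (P (pre p k, i)) ((pre p k).length + 1)).isSome = true := by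
        refine isSome_boundedFind_iff.2 ⟨j, by simp; omega, ?_⟩
        have := Nat.Partrec.Code.evaln_mono (show s ≤ k by omega) hs
        simp only [P, length_pre, take_pre p (show j ≤ k by omega)]
        exact Option.isSome_iff_exists.2 ⟨y, this⟩
      have hi : haltsOn i p := ⟨j, hj⟩
      simp only [hfind, jump, hi, cond_true, if_true]
    · refine ⟨0, fun k _ => ?_⟩
      have hfind : (boundedFind (P (pre p k, i)) ((pre p k).length + 1)).isSome = false := by
        rw [Bool.eq_false_iff, ne_eq, isSome_boundedFind_iff]
        rintro ⟨j, hj, hP⟩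
        obtain ⟨y, hy⟩ := Option.isSome_iff_exists.1 hP
        have hjk : j ≤ k := by simp at hj; omega
        simp only [take_pre p hjk] at hy
        exact hi ⟨j, Part.dom_iff_mem.2 ⟨y, Nat.Partrec.Code.evaln_sound hy⟩⟩
      simp only [hfind, jump, hi, cond_false, if_false]

theorem ComputableFn.limitComputableFn_limB_comp {G : Baire →. Baire} (hG : ComputableFn G) :
    LimitComputableFn (limB.comp G) := by
  obtain ⟨η, hη, hmono, happ⟩ := hG
  refine ⟨fun u m => Nat.rec 0 (fun i y => (η u (Nat.pair i m)).getD y) u.length, ?_, ?_⟩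
  · refine Computable.nat_rec (Computable.list_length.comp Computable.fst) (Computable.const 0)
      (h := fun x (y : ℕ × ℕ) => (η x.1 (Nat.pair y.1 x.2)).getD y.2) ?_
    refine Computable.option_getD (hη.comp (Computable.fst.comp Computable.fst) ?_)
      (Computable.snd.comp Computable.snd)
    exact Primrec₂.natPair.to_comp.comp (Computable.fst.comp Computable.snd)
      (Computable.snd.comp Computable.fst)
  · intro p s hs m
    obtain ⟨r, hr, hs⟩ := mem_comp_iff.1 hs
    obtain ⟨i₀, hi₀⟩ := mem_limB_iff.1 hs m
    obtain ⟨k₁, hk₁⟩ := happ p r hr (Nat.pair i₀ m)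
    have hcorrect : ∀ k i y, i₀ ≤ i → η (pre p k) (Nat.pair i m) = some y → y = s m := by
      intro k i y hi hy
      obtain ⟨k', hk'⟩ := happ p r hr (Nat.pair i m)
      have h₁ := hmono _ _ _ _ (pre_prefix p (le_max_left k k')) hy
      have h₂ := hmono _ _ _ _ (pre_prefix p (le_max_right k k')) hk'
      rw [h₁, Option.some_inj] at h₂
      rw [h₂, hi₀ i hi]
    refine ⟨max k₁ (i₀ + 1), fun k hk => ?_⟩
    have h₀ := hmono _ _ _ _ (pre_prefix p (show k₁ ≤ k by omega)) hk₁
    have key : ∀ K, i₀ + 1 ≤ K → (Nat.rec 0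
        (fun i y => (η (pre p k) (Nat.pair i m)).getD y) K : ℕ) = s m := by
      intro K hK
      induction K, hK using Nat.le_induction with
      | base => simp [h₀, hi₀ i₀ le_rfl]
      | succ K hK ih =>
        simp only [ih]
        cases hy : η (pre p k) (Nat.pair K m) with
        | none => rfl
        | some y => exact hcorrect k K y (by omega) hy
    simpa using key k (by omega)

theorem LowFn.limitComputableFn_jump_comp {F : Baire →. Baire} (hF : LowFn F) :
    LimitComputableFn ((jump : Baire →. Baire).comp F) := by
  obtain ⟨G, hG, rfl⟩ := hF
  refine hG.limitComputableFn_limB_comp.mono fun p s hs => ?_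
  obtain ⟨q, hq, hs⟩ := mem_comp_iff.1 hs
  obtain rfl : jump q = s := by simpa [eq_comm] using hs
  obtain ⟨r, hr, hq⟩ := mem_comp_iff.1 hq
  obtain ⟨s, hs, hq⟩ := mem_comp_iff.1 hq
  rw [mem_jumpInv_iff.1 hq]
  exact mem_comp_iff.2 ⟨r, hr, hs⟩

theorem lowFn_of_limitComputableFn_jump_comp {F : Baire →. Baire}
    (hF : LimitComputableFn ((jump : Baire →. Baire).comp F)) : LowFn F := by
  obtain ⟨η, hη, happ⟩ := hF
  let g : Baire → Baire := fun p m => η (pre p m.unpair.1) m.unpair.2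
  refine ⟨fun p => (F p).map fun _ => g p, ?_, ?_⟩
  · refine ⟨fun v m => bif decide (m.unpair.1 ≤ v.length) then
      some (η (v.take m.unpair.1) m.unpair.2) else none, ?_, ?_, ?_⟩
    · have h₁ : Primrec fun x : List ℕ × ℕ => x.2.unpair.1 :=
        Primrec.fst.comp (Primrec.unpair.comp Primrec.snd)
      have h₂ : Primrec fun x : List ℕ × ℕ => x.2.unpair.2 :=
        Primrec.snd.comp (Primrec.unpair.comp Primrec.snd)
      refine Computable.cond
        (Primrec.nat_le.comp h₁ (Primrec.list_length.comp Primrec.fst)).decide.to_comp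
        (Computable.option_some.comp (hη.comp ?_ h₂.to_comp)) (Computable.const none)
      exact (Primrec.list_take.comp h₁ Primrec.fst).to_comp
    · rintro u v m y ⟨w, rfl⟩ hu
      by_cases hm : m.unpair.1 ≤ u.length
      · have hm' : m.unpair.1 ≤ (u ++ w).length := by simp; omega
        simp only [hm, hm', decide_true, cond_true] at hu ⊢
        rwa [List.take_append_of_le_length hm]
      · simp [hm] at hu
    · intro p r hr m
      obtain ⟨q, -, rfl⟩ := (Part.mem_map_iff _).1 hr
      exact ⟨m.unpair.1, by simp [g, List.take_of_length_le]⟩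
  · have hlim : ∀ p q, q ∈ F p → jump q ∈ limB (g p) := by
      intro p q hq
      refine mem_limB_iff.2 fun n => ?_
      obtain ⟨k₀, hk₀⟩ := happ p (jump q) (mem_comp_iff.2 ⟨q, hq, by simp⟩) n
      exact ⟨k₀, fun i hi => by simpa [g] using hk₀ i hi⟩
    funext p
    ext q
    constructor
    · intro hq
      exact mem_comp_iff.2 ⟨g p, (Part.mem_map_iff _).2 ⟨q, hq, rfl⟩,
        mem_comp_iff.2 ⟨jump q, hlim p q hq, mem_jumpInv_iff.2 rfl⟩⟩
    · intro hq
      obtain ⟨r, hr, hq⟩ := mem_comp_iff.1 hq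
      obtain ⟨q', hq', rfl⟩ := (Part.mem_map_iff _).1 hr
      obtain ⟨s, hs, hq⟩ := mem_comp_iff.1 hq
      have := (mem_jumpInv_iff.1 hq).trans (Part.mem_unique hs (hlim p q' hq'))
      rwa [jump_injective this]

/-- If the jump of the output of `F` can be approximated, then so can every limit computable
function of the output of `F`: the jump decides from which stage on a cell is stable. -/
theorem LimitComputableFn.comp_of_jump_comp {F H : Baire →. Baire}
    (hF : LimitComputableFn ((jump : Baire →. Baire).comp F)) (hH : LimitComputableFn H) :
    LimitComputableFn (H.comp F) := by
  obtain ⟨β, hβ, hF⟩ := hF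
  obtain ⟨η, hη, hH⟩ := hH
  let P : ℕ → List ℕ → Bool := fun a v =>
    decide (a.unpair.2.unpair.1 ≤ v.length) && !(η v a.unpair.1 == a.unpair.2.unpair.2)
  have hP : Computable₂ P := by
    have ha : Primrec fun x : ℕ × List ℕ => x.1.unpair.2.unpair :=
      Primrec.unpair.comp (Primrec.snd.comp (Primrec.unpair.comp Primrec.fst))
    refine Primrec.and.to_comp.comp (Primrec.nat_le.comp (Primrec.fst.comp ha)
      (Primrec.list_length.comp Primrec.snd)).decide.to_comp
      (Primrec.not.to_comp.comp (Primrec.beq.to_comp.comp (hη.comp Computable.snd ?_)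
        (Primrec.snd.comp ha).to_comp))
    exact (Primrec.fst.comp (Primrec.unpair.comp Primrec.fst)).to_comp
  obtain ⟨e, he, hhalt⟩ := exists_computable_haltsOn hP
  let S : List ℕ × ℕ → ℕ → Bool := fun x t => β x.1 (e (Nat.pair x.2 t)) == 0
  have hS : Computable₂ S := by
    refine Primrec.beq.to_comp.comp (hβ.comp (Computable.fst.comp Computable.fst)
      (he.comp ?_)) (Computable.const 0)
    exact Primrec₂.natPair.to_comp.comp (Computable.snd.comp Computable.fst) Computable.snd
  refine ⟨fun u n => ((boundedFind (S (u, n)) u.length).getD 0).unpair.2, ?_, ?_⟩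
  · refine Computable.snd.comp (Computable.unpair.comp (Computable.option_getD
      (computable_boundedFind hS (Computable.list_length.comp Computable.fst))
      (Computable.const 0)))
  · intro p r hr n
    obtain ⟨q, hq, hr⟩ := mem_comp_iff.1 hr
    have happ := hF p (jump q) (mem_comp_iff.2 ⟨q, hq, by simp⟩)
    have hzero : ∀ t, jump q (e (Nat.pair n t)) = 0 ↔
        ∀ k, t.unpair.1 ≤ k → η (pre q k) n = t.unpair.2 := by
      intro t
      simp [jump, hhalt, P]
    obtain ⟨j, hj⟩ := hH q r hr n
    have hex : ∃ t, jump q (e (Nat.pair n t)) = 0 :=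
      ⟨Nat.pair j (r n), (hzero _).2 (by simpa using hj)⟩
    have hval : (Nat.find hex).unpair.2 = r n := by
      have h := (hzero _).1 (Nat.find_spec hex) (max j (Nat.find hex).unpair.1)
        (le_max_right _ _)
      rw [← h, hj _ (le_max_left _ _)]
    choose k₀ hk₀ using fun t => happ (e (Nat.pair n t))
    refine ⟨(Finset.range (Nat.find hex + 1)).sup k₀ + Nat.find hex + 1, fun k hk => ?_⟩
    have hβ : ∀ t ≤ Nat.find hex, β (pre p k) (e (Nat.pair n t)) = jump q (e (Nat.pair n t)) := by
      intro t ht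
      refine hk₀ t k ?_
      have := Finset.le_sup (f := k₀) (Finset.mem_range.2 (Nat.lt_succ_of_le ht))
      simp only [Nat.succ_eq_add_one] at this
      omega
    have hfind : boundedFind (S (pre p k, n)) (pre p k).length = some (Nat.find hex) := by
      refine boundedFind_eq_some (by rw [length_pre]; omega) ?_ fun s hs => ?_
      · simp only [S, hβ _ le_rfl, Nat.find_spec hex, beq_self_eq_true]
      · simp only [S, hβ s hs.le, beq_eq_false_iff_ne]
        exact Nat.find_min hex hs
    simp only [hfind, Option.getD_some, hval]

/-- **Characterization of low functions.** A partial function `F :⊆ ℕ^ℕ → ℕ^ℕ` is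
low if and only if `G ∘ F` is limit computable for every limit computable
`G :⊆ ℕ^ℕ → ℕ^ℕ`. -/
theorem low_characterization (F : Baire →. Baire) :
    LowFn F ↔
      ∀ G : Baire →. Baire, LimitComputableFn G → LimitComputableFn (G.comp F) := by
  exact ⟨fun hF _ hG => hF.limitComputableFn_jump_comp.comp_of_jump_comp hG,
    fun h => lowFn_of_limitComputableFn_jump_comp (h _ limitComputableFn_jump)⟩

end LimitComp
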